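/- Let q ≥ 2, let G be an SYK graph and let e₁ ≠ e₂ be fermionic lines of G belonging to a common face such that {e₁, e₂} is not a 2-cut of G. Then there exists an SYK graph G' with |V(G')| = |V(G)| and F(G') > F(G); in particular G does not maximize the number of faces among SYK graphs with |V(G)| vertices. -/

import Mathlib

namespace SYK

/-- A pre-SYK graph: a finite nonempty vertex set `V`, darts `V × Fin q`
(`Fin q` standing for the strand labels `{1,…,q}`), a fixed-point-free
involutive fermionic pairing `ferm` of the darts, and a fixed-point-free
involutive disorder pairing `dis` of the vertices.  (Connectivity of the
fermionic multigraph is *not* required.) -/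
structure PreGraph (q : ℕ) where
  V : Type
  [fintypeV : Fintype V]
  [decEqV : DecidableEq V]
  [nonemptyV : Nonempty V]
  ferm : Equiv.Perm (V × Fin q)
  dis : Equiv.Perm V
  ferm_invol : ∀ d, ferm (ferm d) = d
  ferm_fpf : ∀ d, ferm d ≠ d
  dis_invol : ∀ v, dis (dis v) = v
  dis_fpf : ∀ v, dis v ≠ v

attribute [instance] PreGraph.fintypeV PreGraph.decEqV PreGraph.nonemptyV

variable {q : ℕ}

/-- The darts of a pre-SYK graph. -/
abbrev PreGraph.Dart (H : PreGraph q) : Type := H.V × Fin q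

/-- Relabelling of darts induced by a map of vertices. -/
def dartMap {q : ℕ} {α β : Type} (ι : α → β) (d : α × Fin q) : β × Fin q :=
  (ι d.1, d.2)

/-- The involution `π̂` on darts induced by the disorder pairing:
`π̂ (v, m) = (π v, m)`. -/
def PreGraph.dishat (H : PreGraph q) : Equiv.Perm H.Dart :=
  Equiv.prodCongr H.dis (Equiv.refl (Fin q))

/-- Adjacency of vertices in the fermionic multigraph `G₀`, where fermionic
lines having a dart in `S` are deleted. -/
def PreGraph.adj0Off (H : PreGraph q) (S : Set H.Dart) (v w : H.V) : Prop :=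
  ∃ m m' : Fin q, (v, m) ∉ S ∧ H.ferm (v, m) = (w, m')

/-- Adjacency of vertices in the fermionic multigraph `G₀`. -/
def PreGraph.adj0 (H : PreGraph q) : H.V → H.V → Prop :=
  H.adj0Off ∅

/-- Connectivity of the fermionic multigraph `G₀`. -/
def PreGraph.Conn0 (H : PreGraph q) : Prop :=
  ∀ v w : H.V, Relation.ReflTransGen H.adj0 v w

/-- Adjacency of vertices in the multigraph `G⁺` (one edge per fermionic line
and one edge per disorder line), where fermionic lines having a dart in `S`
are deleted. -/
def PreGraph.adjPlusOff (H : PreGraph q) (S : Set H.Dart) (v w : H.V) : Prop :=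
  H.adj0Off S v w ∨ H.dis v = w

/-- The subgroup of dart permutations generated by the fermionic pairing `τ`
and the induced disorder involution `π̂`; faces are its orbits. -/
def PreGraph.faceGroup (H : PreGraph q) : Subgroup (Equiv.Perm H.Dart) :=
  Subgroup.closure {H.ferm, H.dishat}

/-- Two darts lie in a common face. -/
def PreGraph.SameFace (H : PreGraph q) (d₁ d₂ : H.Dart) : Prop :=
  d₁ ∈ MulAction.orbit H.faceGroup d₂

/-- `F H`: the number of faces, i.e. of orbits of `⟨τ, π̂⟩` on the darts. -/
noncomputable def PreGraph.F (H : PreGraph q) : ℕ :=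
  Nat.card (MulAction.orbitRel.Quotient H.faceGroup H.Dart)

/-- The number of vertices `|V(H)|`. -/
noncomputable def PreGraph.nV (H : PreGraph q) : ℕ :=
  Nat.card H.V

/-- `δ(H) = F(H) − (q−1)·|V(H)|/2` (the division is exact: `|V(H)|` is even). -/
noncomputable def PreGraph.delta (H : PreGraph q) : ℤ :=
  (H.F : ℤ) - ((q : ℤ) - 1) * ((H.nV / 2 : ℕ) : ℤ)

/-- `e` is a fermionic line: the set of the two darts of a `τ`-orbit. -/
def PreGraph.IsLine (H : PreGraph q) (e : Set H.Dart) : Prop :=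
  ∃ d : H.Dart, e = {d, H.ferm d}

/-- The fermionic lines `e₁` and `e₂` belong to a common face. -/
def PreGraph.LinesShareFace (H : PreGraph q) (e₁ e₂ : Set H.Dart) : Prop :=
  ∃ d₁ ∈ e₁, ∃ d₂ ∈ e₂, H.SameFace d₁ d₂

/-- Deleting the fermionic lines with a dart in `S` disconnects `G₀`. -/
def PreGraph.Disconnects0 (H : PreGraph q) (S : Set H.Dart) : Prop :=
  ¬ ∀ v w : H.V, Relation.ReflTransGen (H.adj0Off S) v w

/-- Deleting the fermionic lines with a dart in `S` disconnects `G⁺`. -/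
def PreGraph.DisconnectsPlus (H : PreGraph q) (S : Set H.Dart) : Prop :=
  ¬ ∀ v w : H.V, Relation.ReflTransGen (H.adjPlusOff S) v w

/-- `{e₁, e₂}` is a 2-cut of the multigraph `G⁺`. -/
def PreGraph.TwoCutPlus (H : PreGraph q) (e₁ e₂ : Set H.Dart) : Prop :=
  H.DisconnectsPlus (e₁ ∪ e₂)

/-- `{e₁, e₂}` is a 2-cut of the fermionic multigraph `G₀`. -/
def PreGraph.TwoCut0 (H : PreGraph q) (e₁ e₂ : Set H.Dart) : Prop :=
  H.Disconnects0 (e₁ ∪ e₂)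

/-- An SYK graph: a pre-SYK graph whose fermionic multigraph `G₀` is
connected. -/
structure Graph (q : ℕ) extends PreGraph q where
  conn : toPreGraph.Conn0

/-- `G` is (a relabelling of) the minimal graph `G_min`: two vertices `a, b`
with `π a = b` and `τ (a, m) = (b, m)` for all `m`. -/
def Graph.IsMin (G : Graph q) : Prop :=
  ∃ a b : G.V, a ≠ b ∧ (∀ v : G.V, v = a ∨ v = b) ∧ G.dis a = b ∧
    ∀ m : Fin q, G.ferm (a, m) = (b, m)

/-- `G'` is obtained from `G` by a melonic move: two new vertices `x, y` with
`π x = y` are inserted on a fermionic line `{d, τ d}` of `G`; the strand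
`⟨0, _⟩ : Fin q` plays the role of the label `1` of `{1,…,q}`. -/
def Graph.MelonicMove (G G' : Graph q) : Prop :=
  ∃ (x y : G'.V) (ι : G.V → G'.V) (d : G.V × Fin q),
    Function.Injective ι ∧ x ≠ y ∧
    (∀ v' : G'.V, (¬ ∃ v, ι v = v') ↔ (v' = x ∨ v' = y)) ∧
    G'.dis x = y ∧
    (∀ v, G'.dis (ι v) = ι (G.dis v)) ∧
    G'.ferm (dartMap ι d) = (x, ⟨0, d.2.pos⟩) ∧
    G'.ferm (y, ⟨0, d.2.pos⟩) = dartMap ι (G.ferm d) ∧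
    (∀ k : Fin q, k ≠ ⟨0, d.2.pos⟩ → G'.ferm (x, k) = (y, k)) ∧
    (∀ d' : G.V × Fin q, d' ≠ d → d' ≠ G.ferm d →
      G'.ferm (dartMap ι d') = dartMap ι (G.ferm d'))

/-- Isomorphism of SYK graphs: a bijection of darts commuting with the
fermionic pairings and the induced disorder involutions, and mapping the `q`
darts of each vertex onto the `q` darts of a single vertex. -/
def Graph.Isomorphic (G G' : Graph q) : Prop :=
  ∃ φ : (G.V × Fin q) ≃ (G'.V × Fin q),
    (∀ d, φ (G.ferm d) = G'.ferm (φ d)) ∧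
    (∀ d, φ (G.toPreGraph.dishat d) = G'.toPreGraph.dishat (φ d)) ∧
    ∀ v : G.V, ∃ v' : G'.V, ∀ m : Fin q, (φ (v, m)).1 = v'

/-- `G` is melonic: isomorphic to a graph obtained from the minimal graph
`G_min` by a finite sequence of melonic moves. -/
def Graph.IsMelonic (G : Graph q) : Prop :=
  ∃ G₀ Gn : Graph q, G₀.IsMin ∧ Relation.ReflTransGen Graph.MelonicMove G₀ Gn ∧
    G.Isomorphic Gn


/-- The pre-SYK graph obtained from `H` by replacing the fermionic pairing,
keeping the vertex set and the disorder pairing. -/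
def PreGraph.withFerm (H : PreGraph q) (f : Equiv.Perm (H.V × Fin q))
    (hi : ∀ d, f (f d) = d) (hf : ∀ d, f d ≠ d) : PreGraph q where
  V := H.V
  fintypeV := H.fintypeV
  decEqV := H.decEqV
  nonemptyV := H.nonemptyV
  ferm := f
  dis := H.dis
  ferm_invol := hi
  ferm_fpf := hf
  dis_invol := H.dis_invol
  dis_fpf := H.dis_fpf

/-- `G` is the gluing `G₁^{(e₁)} ⋆ G₂^{(e₂)}` where `e₁ = {d₁, τ₁ d₁}` and
`e₂ = {d₂, τ₂ d₂}`: the vertex set is the disjoint union of those of `G₁` and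
`G₂`, the disorder pairing is the union of the two disorder pairings, and the
fermionic pairing agrees with `τ₁`, `τ₂` outside `e₁ ∪ e₂` and pairs `d₁` with
`d₂`, and `τ₁ d₁` with `τ₂ d₂`. -/
def Graph.IsStarGluing (G₁ G₂ G : Graph q) (d₁ : G₁.V × Fin q)
    (d₂ : G₂.V × Fin q) : Prop :=
  ∃ (ι₁ : G₁.V → G.V) (ι₂ : G₂.V → G.V),
    Function.Injective ι₁ ∧ Function.Injective ι₂ ∧
    (∀ v₁ v₂, ι₁ v₁ ≠ ι₂ v₂) ∧
    (∀ v : G.V, (∃ v₁, ι₁ v₁ = v) ∨ (∃ v₂, ι₂ v₂ = v)) ∧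
    (∀ v, G.dis (ι₁ v) = ι₁ (G₁.dis v)) ∧
    (∀ v, G.dis (ι₂ v) = ι₂ (G₂.dis v)) ∧
    G.ferm (dartMap ι₁ d₁) = dartMap ι₂ d₂ ∧
    G.ferm (dartMap ι₁ (G₁.ferm d₁)) = dartMap ι₂ (G₂.ferm d₂) ∧
    (∀ d, d ≠ d₁ → d ≠ G₁.ferm d₁ →
      G.ferm (dartMap ι₁ d) = dartMap ι₁ (G₁.ferm d)) ∧
    (∀ d, d ≠ d₂ → d ≠ G₂.ferm d₂ →
      G.ferm (dartMap ι₂ d) = dartMap ι₂ (G₂.ferm d))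

/-- `G` is the gluing `G₁^{(e₁)} ⋆̄ G₂^{(e₂)}`: as in `IsStarGluing` but the
fermionic pairing pairs `d₁` with `τ₂ d₂`, and `τ₁ d₁` with `d₂`. -/
def Graph.IsBarGluing (G₁ G₂ G : Graph q) (d₁ : G₁.V × Fin q)
    (d₂ : G₂.V × Fin q) : Prop :=
  ∃ (ι₁ : G₁.V → G.V) (ι₂ : G₂.V → G.V),
    Function.Injective ι₁ ∧ Function.Injective ι₂ ∧
    (∀ v₁ v₂, ι₁ v₁ ≠ ι₂ v₂) ∧
    (∀ v : G.V, (∃ v₁, ι₁ v₁ = v) ∨ (∃ v₂, ι₂ v₂ = v)) ∧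
    (∀ v, G.dis (ι₁ v) = ι₁ (G₁.dis v)) ∧
    (∀ v, G.dis (ι₂ v) = ι₂ (G₂.dis v)) ∧
    G.ferm (dartMap ι₁ d₁) = dartMap ι₂ (G₂.ferm d₂) ∧
    G.ferm (dartMap ι₁ (G₁.ferm d₁)) = dartMap ι₂ d₂ ∧
    (∀ d, d ≠ d₁ → d ≠ G₁.ferm d₁ →
      G.ferm (dartMap ι₁ d) = dartMap ι₁ (G₁.ferm d)) ∧
    (∀ d, d ≠ d₂ → d ≠ G₂.ferm d₂ →
      G.ferm (dartMap ι₂ d) = dartMap ι₂ (G₂.ferm d))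

/-- `H''` is the contraction of the disorder line `{v, w}` of `H`: its vertex
set is `V(H) ∖ {v, w}` (embedded via `ι`), its disorder pairing is the
restriction of that of `H`, and its fermionic pairing pairs `τ (v, m)` with
`τ (w, m)` for each strand `m` and agrees with `τ` on all other darts. -/
def PreGraph.IsContraction (H H'' : PreGraph q) (v w : H.V) : Prop :=
  ∃ ι : H''.V → H.V,
    Function.Injective ι ∧
    (∀ u : H.V, (∃ u'', ι u'' = u) ↔ (u ≠ v ∧ u ≠ w)) ∧
    (∀ u, ι (H''.dis u) = H.dis (ι u)) ∧
    (∀ m : Fin q, ∃ a b : H''.V × Fin q,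
      dartMap ι a = H.ferm (v, m) ∧ dartMap ι b = H.ferm (w, m) ∧
      H''.ferm a = b) ∧
    (∀ d : H''.V × Fin q,
      (∀ m : Fin q, dartMap ι d ≠ H.ferm (v, m) ∧ dartMap ι d ≠ H.ferm (w, m)) →
      dartMap ι (H''.ferm d) = H.ferm (dartMap ι d))

/-- `HL` is the closure of the side `side ⊆ V(G)` of the graph `G` cut along
the fermionic lines `e₁, e₂`: its vertex set is `{v | side v}` (embedded via
`ι`), its disorder pairing is the restriction of that of `G`, and its
fermionic pairing pairs the `side`-dart of `e₁` with the `side`-dart of `e₂`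
and agrees with `τ` on all darts not in `e₁ ∪ e₂`. -/
def Graph.IsSideClose (G : Graph q) (side : G.V → Prop)
    (e₁ e₂ : Set (G.V × Fin q)) (HL : PreGraph q) : Prop :=
  ∃ ι : HL.V → G.V,
    Function.Injective ι ∧
    (∀ v : G.V, (∃ u, ι u = v) ↔ side v) ∧
    (∀ u, ι (HL.dis u) = G.dis (ι u)) ∧
    (∃ a b : HL.V × Fin q, dartMap ι a ∈ e₁ ∧ dartMap ι b ∈ e₂ ∧
      HL.ferm a = b) ∧
    (∀ d : HL.V × Fin q, dartMap ι d ∉ e₁ ∪ e₂ →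
      dartMap ι (HL.ferm d) = G.ferm (dartMap ι d))


/-- A function on darts invariant under `τ` and `π̂` is constant on faces. -/
theorem PreGraph.SameFace.apply_eq {H : PreGraph q} {α : Type*} {f : H.Dart → α}
    (hτ : ∀ d, f (H.ferm d) = f d) (hπ : ∀ d, f (H.dishat d) = f d)
    {d₁ d₂ : H.Dart} (h : H.SameFace d₁ d₂) : f d₁ = f d₂ := by
  obtain ⟨⟨g, hg⟩, rfl⟩ := h
  change f (g d₂) = f d₂
  induction hg using Subgroup.closure_induction generalizing d₂ with
  | mem x hx =>
    rcases hx with rfl | rfl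
    · exact hτ _
    · exact hπ _
  | one => rfl
  | mul x y _ _ hx hy => rw [Equiv.Perm.mul_apply, hx, hy]
  | inv x _ hx =>
    rw [← hx (d₂ := x⁻¹ d₂)]
    exact congrArg f (x.apply_symm_apply d₂)

theorem PreGraph.SameFace.refl (H : PreGraph q) (d : H.Dart) : H.SameFace d d :=
  MulAction.mem_orbit_self d

theorem PreGraph.SameFace.symm {H : PreGraph q} {d₁ d₂ : H.Dart} (h : H.SameFace d₁ d₂) :
    H.SameFace d₂ d₁ :=
  MulAction.mem_orbit_symm.mp h

theorem PreGraph.SameFace.trans {H : PreGraph q} {d₁ d₂ d₃ : H.Dart} (h : H.SameFace d₁ d₂)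
    (h' : H.SameFace d₂ d₃) : H.SameFace d₁ d₃ := by
  have h₂ : MulAction.orbit H.faceGroup d₂ = MulAction.orbit H.faceGroup d₃ :=
    MulAction.orbit_eq_iff.mpr h'
  change d₁ ∈ MulAction.orbit H.faceGroup d₃
  rwa [← h₂]

theorem PreGraph.sameFace_ferm (H : PreGraph q) (d : H.Dart) : H.SameFace (H.ferm d) d :=
  ⟨⟨H.ferm, Subgroup.subset_closure (by simp)⟩, rfl⟩

theorem PreGraph.sameFace_dishat (H : PreGraph q) (d : H.Dart) : H.SameFace (H.dishat d) d :=
  ⟨⟨H.dishat, Subgroup.subset_closure (by simp)⟩, rfl⟩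

/-- The face containing a dart. -/
abbrev PreGraph.face (H : PreGraph q) (d : H.Dart) :
    MulAction.orbitRel.Quotient H.faceGroup H.Dart :=
  Quotient.mk'' d

theorem PreGraph.face_eq_iff {H : PreGraph q} {d₁ d₂ : H.Dart} :
    H.face d₁ = H.face d₂ ↔ H.SameFace d₁ d₂ :=
  Quotient.eq''

theorem PreGraph.dishat_dishat (H : PreGraph q) (d : H.Dart) : H.dishat (H.dishat d) = d :=
  Prod.ext (H.dis_invol d.1) rfl

theorem PreGraph.dishat_ne (H : PreGraph q) (d : H.Dart) : H.dishat d ≠ d :=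
  fun h => H.dis_fpf d.1 (congrArg Prod.fst h)

/-- A set of representatives of the disorder lines. -/
theorem PreGraph.exists_disorder_representatives (H : PreGraph q) :
    ∃ S : Finset H.V, (∀ v, v ∈ S ∨ H.dis v ∈ S) ∧ H.nV = 2 * S.card := by
  let e := Fintype.equivFin H.V
  let S : Finset H.V := {v | e v < e (H.dis v)}
  have hS : ∀ v, v ∈ S ↔ e v < e (H.dis v) := by simp [S]
  have hcompl : ∀ v, v ∉ S ↔ H.dis v ∈ S := by
    intro v
    have hne : e (H.dis v) ≠ e v := fun h => H.dis_fpf v (e.injective h)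
    rw [hS, hS, H.dis_invol, not_lt]
    exact ⟨fun h => lt_of_le_of_ne h hne, le_of_lt⟩
  refine ⟨S, fun v => or_iff_not_imp_left.mpr (hcompl v).mp, ?_⟩
  have hcard : Sᶜ.card = S.card :=
    Finset.card_bij' (fun v _ => H.dis v) (fun v _ => H.dis v)
      (fun v hv => (hcompl v).mp (Finset.mem_compl.mp hv))
      (fun v hv => Finset.mem_compl.mpr ((hcompl _).mpr (by rwa [H.dis_invol])))
      (fun v _ => H.dis_invol v) (fun v _ => H.dis_invol v)
  have := S.card_add_card_compl
  rw [PreGraph.nV, Nat.card_eq_fintype_card]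
  omega

/-- If `G⁺` is connected then the number of faces is at most `(q - 1) * |V| / 2 + 1`: a function
on the faces is determined by its value at one face and by its variations along the strands of
each disorder line. -/
theorem PreGraph.F_le_of_connected (H : PreGraph q) (m₀ : Fin q)
    (hconn : ∀ v w : H.V, Relation.ReflTransGen (H.adjPlusOff ∅) v w)
    (S : Finset H.V) (hS : ∀ v, v ∈ S ∨ H.dis v ∈ S) :
    H.F ≤ S.card * (q - 1) + 1 := by
  classical
  obtain ⟨v₀⟩ := H.nonemptyV
  let Q := MulAction.orbitRel.Quotient H.faceGroup H.Dart
  have : Fintype Q := Fintype.ofFinite Q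
  let ψ : (Q → ℚ) →ₗ[ℚ] (S × {m : Fin q // m ≠ m₀} → ℚ) × ℚ :=
    { toFun := fun f => (fun p => f (H.face (p.1, p.2)) - f (H.face (p.1, m₀)),
        f (H.face (v₀, m₀)))
      map_add' := fun f g => by
        ext <;> simp
        ring
      map_smul' := fun c f => by
        ext <;> simp
        ring }
  have hψ : Function.Injective ψ := by
    rw [injective_iff_map_eq_zero]
    intro f hf
    have hbase : f (H.face (v₀, m₀)) = 0 := congrArg Prod.snd hf
    have hdis : ∀ v m, f (H.face (H.dis v, m)) = f (H.face (v, m)) := fun v m =>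
      congrArg f (PreGraph.face_eq_iff.mpr (H.sameFace_dishat (v, m)))
    have hrep : ∀ v ∈ S, ∀ m, f (H.face (v, m)) = f (H.face (v, m₀)) := by
      intro v hv m
      by_cases hm : m = m₀
      · rw [hm]
      · exact sub_eq_zero.mp (congrFun (congrArg Prod.fst hf) (⟨v, hv⟩, ⟨m, hm⟩))
    have hstrand : ∀ v m, f (H.face (v, m)) = f (H.face (v, m₀)) := by
      intro v m
      rcases hS v with hv | hv
      · exact hrep v hv m
      · rw [← hdis v m, ← hdis v m₀, hrep _ hv]
    have hzero : ∀ v, f (H.face (v, m₀)) = 0 := by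
      intro v
      induction hconn v₀ v with
      | refl => exact hbase
      | tail _ hadj ih =>
        rcases hadj with ⟨m, m', -, h⟩ | h
        · rw [← hstrand _ m', ← h, PreGraph.face_eq_iff.mpr (H.sameFace_ferm _), hstrand, ih]
        · rw [← h, hdis, ih]
    funext x
    induction x using Quotient.inductionOn' with
    | h d => exact (hstrand d.1 d.2).trans (hzero d.1)
  have h := LinearMap.finrank_le_finrank_of_injective hψ
  simpa [PreGraph.F, Q, Nat.card_eq_fintype_card, Fintype.card_subtype_compl] using h

/-- A cyclic chain of `k + 1` disorder lines `{(i, false), (i, true)}`: the strand `m₀` joins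
`(i, false)` to `(i + 1, true)` and all other strands join `(i, false)` to `(i, true)`. -/
def necklaceFerm (k : ℕ) (m₀ : Fin q) (d : (Fin (k + 1) × Bool) × Fin q) :
    (Fin (k + 1) × Bool) × Fin q :=
  if d.2 = m₀ then ((bif d.1.2 then d.1.1 - 1 else d.1.1 + 1, !d.1.2), d.2)
  else ((d.1.1, !d.1.2), d.2)

theorem necklaceFerm_involutive (k : ℕ) (m₀ : Fin q) :
    Function.Involutive (necklaceFerm k m₀) := by
  rintro ⟨⟨i, b⟩, m⟩
  by_cases hm : m = m₀ <;> cases b <;> simp [necklaceFerm, hm]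

/-- The pre-SYK graph with fermionic pairing `necklaceFerm`. -/
def necklace (k : ℕ) (m₀ : Fin q) : PreGraph q where
  V := Fin (k + 1) × Bool
  ferm := (necklaceFerm_involutive k m₀).toPerm
  dis := Equiv.prodCongr (Equiv.refl _) Equiv.boolNot
  ferm_invol := necklaceFerm_involutive k m₀
  ferm_fpf := by
    rintro ⟨⟨i, b⟩, m⟩ h
    have h' : (necklaceFerm k m₀ ((i, b), m)).1.2 = b := congrArg (fun d => d.1.2) h
    by_cases hm : m = m₀ <;> simp [necklaceFerm, hm] at h'
  dis_invol := fun ⟨_, b⟩ => Prod.ext rfl (Bool.not_not b)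
  dis_fpf := fun v h => by simpa using congrArg Prod.snd h

theorem necklace_conn0 (k : ℕ) {m₀ m₁ : Fin q} (hm : m₁ ≠ m₀) : (necklace k m₀).Conn0 := by
  have hsymm : Std.Symm (necklace k m₀).adj0 := by
    refine ⟨?_⟩
    rintro v w ⟨m, m', -, h⟩
    exact ⟨m', m, Set.notMem_empty _, by rw [← h, (necklace k m₀).ferm_invol]⟩
  have hflip : ∀ (i : Fin (k + 1)) (b : Bool), (necklace k m₀).adj0 (i, b) (i, !b) := by
    intro i b
    refine ⟨m₁, m₁, Set.notMem_empty _, ?_⟩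
    change necklaceFerm k m₀ ((i, b), m₁) = ((i, !b), m₁)
    simp only [necklaceFerm, if_neg hm]
  have hstep : ∀ i : Fin (k + 1), (necklace k m₀).adj0 (i, false) (i + 1, true) := by
    intro i
    refine ⟨m₀, m₀, Set.notMem_empty _, ?_⟩
    change necklaceFerm k m₀ ((i, false), m₀) = ((i + 1, true), m₀)
    simp only [necklaceFerm, if_true, cond_false, Bool.not_false]
  have hbase : ∀ i : Fin (k + 1),
      Relation.ReflTransGen (necklace k m₀).adj0 ((0 : Fin (k + 1)), false) (i, false) := by
    intro i
    induction i using Fin.induction with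
    | zero => exact .refl
    | succ i ih =>
      have h := hstep i.castSucc
      rw [Fin.coeSucc_eq_succ] at h
      exact (ih.tail h).tail (hflip _ true)
  have hall : ∀ v : (necklace k m₀).V,
      Relation.ReflTransGen (necklace k m₀).adj0 ((0 : Fin (k + 1)), false) v := by
    rintro ⟨i, _ | _⟩
    · exact hbase i
    · exact (hbase i).tail (hflip i false)
  exact fun v w => (symm (hall v)).trans (hall w)

theorem nV_necklace (k : ℕ) (m₀ : Fin q) : (necklace k m₀).nV = 2 * (k + 1) := by
  change Nat.card (Fin (k + 1) × Bool) = _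
  simp [mul_comm]

theorem le_F_necklace (k : ℕ) (m₀ : Fin q) :
    (k + 1) * (q - 1) + 1 ≤ (necklace k m₀).F := by
  classical
  let f : (necklace k m₀).Dart → Option (Fin (k + 1) × {m : Fin q // m ≠ m₀}) := fun d =>
    if h : d.2 = m₀ then none else some (d.1.1, ⟨d.2, h⟩)
  have hτ : ∀ d, f ((necklace k m₀).ferm d) = f d := by
    rintro ⟨⟨i, b⟩, m⟩
    change f (necklaceFerm k m₀ ((i, b), m)) = _
    by_cases hm : m = m₀ <;> simp [f, necklaceFerm, hm]
  have hπ : ∀ d, f ((necklace k m₀).dishat d) = f d := fun _ => rfl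
  let g : MulAction.orbitRel.Quotient (necklace k m₀).faceGroup (necklace k m₀).Dart →
      Option (Fin (k + 1) × {m : Fin q // m ≠ m₀}) :=
    Quotient.lift f fun _ _ h => PreGraph.SameFace.apply_eq hτ hπ h
  have hg : Function.Surjective g := by
    rintro (_ | ⟨i, m, hm⟩)
    · exact ⟨(necklace k m₀).face ((0, false), m₀), dif_pos rfl⟩
    · exact ⟨(necklace k m₀).face ((i, false), m), dif_neg hm⟩
  have h := Nat.card_le_card_of_surjective g hg
  simpa [PreGraph.F, Nat.card_eq_fintype_card, Fintype.card_subtype_compl] using h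

/-- The rotation `τ π̂` along the faces. -/
def PreGraph.rot (H : PreGraph q) : Equiv.Perm H.Dart :=
  H.ferm * H.dishat

theorem PreGraph.rot_pow_succ_apply (H : PreGraph q) (k : ℕ) (d : H.Dart) :
    (H.rot ^ (k + 1)) d = H.ferm (H.dishat ((H.rot ^ k) d)) := by
  rw [pow_succ', Equiv.Perm.mul_apply]
  rfl

/-- The two darts of a fermionic line are never in the same cycle of the rotation. -/
theorem PreGraph.rot_pow_ne_ferm (H : PreGraph q) (k : ℕ) (d : H.Dart) :
    (H.rot ^ k) d ≠ H.ferm d := by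
  induction k using Nat.twoStepInduction generalizing d with
  | zero => exact (H.ferm_fpf d).symm
  | one =>
    intro h
    rw [H.rot_pow_succ_apply] at h
    exact H.dishat_ne d (H.ferm.injective h)
  | more k ih _ =>
    intro h
    apply ih (H.rot d)
    rw [H.rot_pow_succ_apply, EmbeddingLike.apply_eq_iff_eq, pow_succ, Equiv.Perm.mul_apply] at h
    rw [← H.dishat_dishat ((H.rot ^ k) (H.rot d)), h]
    exact (H.ferm_invol _).symm

theorem PreGraph.rot_pow_ne_ferm_rot_pow (H : PreGraph q) (i j : ℕ) (d : H.Dart) :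
    (H.rot ^ i) d ≠ H.ferm ((H.rot ^ j) d) := by
  rcases le_total j i with h | h
  · obtain ⟨l, rfl⟩ := Nat.exists_eq_add_of_le' h
    rw [pow_add, Equiv.Perm.mul_apply]
    exact H.rot_pow_ne_ferm l _
  · obtain ⟨l, rfl⟩ := Nat.exists_eq_add_of_le' h
    intro he
    rw [pow_add, Equiv.Perm.mul_apply] at he
    exact H.rot_pow_ne_ferm l ((H.rot ^ i) d) (by rw [← H.ferm_invol ((H.rot ^ l) _), ← he])

theorem PreGraph.SameFace.exists_rot_pow {H : PreGraph q} {a d : H.Dart} (h : H.SameFace a d) :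
    ∃ k : ℕ, (H.rot ^ k) a = d ∨ (H.rot ^ k) a = H.ferm d := by
  let T : H.Dart → Prop := fun d => ∃ k : ℕ, (H.rot ^ k) a = d ∨ (H.rot ^ k) a = H.ferm d
  have hτ : ∀ d, T d → T (H.ferm d) := by
    rintro d ⟨k, hk | hk⟩
    · exact ⟨k, .inr (by rw [hk, H.ferm_invol])⟩
    · exact ⟨k, .inl hk⟩
  have hπ : ∀ d, T d → T (H.dishat d) := by
    rintro d ⟨k, hk | hk⟩
    · exact ⟨k + 1, .inr (by rw [H.rot_pow_succ_apply, hk])⟩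
    · obtain ⟨l, hl⟩ : ∃ l : ℕ, (H.rot ^ (l + 1)) a = H.ferm d := by
        refine ⟨k + (orderOf H.rot - 1), ?_⟩
        have : k + (orderOf H.rot - 1) + 1 = k + orderOf H.rot := by
          have := orderOf_pos H.rot
          omega
        rw [this, pow_add, pow_orderOf_eq_one, mul_one, hk]
      rw [H.rot_pow_succ_apply, EmbeddingLike.apply_eq_iff_eq] at hl
      exact ⟨l, .inl (by rw [← hl, H.dishat_dishat])⟩
  have hT : T a ↔ T d := iff_of_eq <| PreGraph.SameFace.apply_eq (f := T)
    (fun d => propext ⟨fun h => by simpa [H.ferm_invol] using hτ _ h, hτ d⟩)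
    (fun d => propext ⟨fun h => by simpa [H.dishat_dishat] using hπ _ h, hπ d⟩) h
  exact hT.mp ⟨0, .inl rfl⟩

/-- Exchanging the partners of the darts `a` and `c`. -/
def PreGraph.exchange (H : PreGraph q) (a c : H.Dart) : PreGraph q :=
  H.withFerm (Equiv.swap a c * H.ferm * Equiv.swap a c)
    (fun d => by simp [H.ferm_invol])
    (fun d h => H.ferm_fpf (Equiv.swap a c d) (by simpa [Equiv.swap_apply_eq_iff] using h))

theorem PreGraph.exchange_ferm_apply (H : PreGraph q) (a c d : H.Dart) :
    (H.exchange a c).ferm d = Equiv.swap a c (H.ferm (Equiv.swap a c d)) :=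
  rfl

theorem PreGraph.exchange_ferm_of_ne (H : PreGraph q) {a c d : H.Dart} (h₁ : d ≠ a) (h₂ : d ≠ c)
    (h₃ : d ≠ H.ferm a) (h₄ : d ≠ H.ferm c) : (H.exchange a c).ferm d = H.ferm d := by
  rw [H.exchange_ferm_apply, Equiv.swap_apply_of_ne_of_ne h₁ h₂, Equiv.swap_apply_of_ne_of_ne]
  · exact fun h => h₃ (by rw [← h, H.ferm_invol])
  · exact fun h => h₄ (by rw [← h, H.ferm_invol])

/-- Exchanging the partners of two darts of distinct fermionic lines in the same cycle of the
rotation splits a face. -/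
theorem PreGraph.F_lt_F_exchange (H : PreGraph q) {a c : H.Dart} (hac : a ≠ c)
    (h : ∃ k : ℕ, (H.rot ^ k) a = c) : H.F < (H.exchange a c).F := by
  classical
  have hk := Nat.find_spec h
  have hmin : ∀ i < Nat.find h, (H.rot ^ i) a ≠ c := fun i hi => Nat.find_min h hi
  generalize Nat.find h = k at hk hmin
  obtain _ | k := k
  · exact absurd hk hac
  have hne : ∀ i j, (H.rot ^ i) a ≠ H.ferm ((H.rot ^ j) a) :=
    fun i j => H.rot_pow_ne_ferm_rot_pow i j a
  have hc : H.ferm c ≠ c := H.ferm_fpf c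
  have hac' : H.ferm c ≠ a := fun e => hne 0 (k + 1) (by rw [hk, e]; rfl)
  have hτa : (H.exchange a c).ferm a = H.ferm c := by
    rw [H.exchange_ferm_apply, Equiv.swap_apply_left, Equiv.swap_apply_of_ne_of_ne hac' hc]
  have hτc : (H.exchange a c).ferm (H.ferm c) = a := by
    rw [← hτa]
    exact (H.exchange a c).ferm_invol a
  have hinner : ∀ i < k, (H.exchange a c).ferm ((H.rot ^ (i + 1)) a) =
      H.dishat ((H.rot ^ i) a) := by
    intro i hi
    rw [H.exchange_ferm_of_ne, H.rot_pow_succ_apply, H.ferm_invol]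
    · intro e
      apply hmin (k - i) (by omega)
      rw [← hk, show k + 1 = (k - i) + (i + 1) by omega, pow_add, Equiv.Perm.mul_apply, e]
    · exact hmin _ (by omega)
    · exact hne _ 0
    · rw [← hk]; exact hne _ _
  have hlast : H.dishat ((H.rot ^ k) a) = H.ferm c := by
    rw [← hk, H.rot_pow_succ_apply, H.ferm_invol]
  -- the arc of the face from `a` to the partner of `c`
  let T : H.Dart → Prop := fun d => ∃ i ≤ k, d = (H.rot ^ i) a ∨ d = H.dishat ((H.rot ^ i) a)
  have hTτ : ∀ d, T d → T ((H.exchange a c).ferm d) := by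
    rintro d ⟨i, hi, rfl | rfl⟩
    · obtain _ | i := i
      · exact ⟨k, le_rfl, .inr (hτa.trans hlast.symm)⟩
      · exact ⟨i, by omega, .inr (hinner i (by omega))⟩
    · rcases hi.lt_or_eq with hi | rfl
      · refine ⟨i + 1, hi, .inl ?_⟩
        rw [← hinner i hi]
        exact (H.exchange a c).ferm_invol _
      · exact ⟨0, Nat.zero_le _, .inl (by rw [hlast]; exact hτc)⟩
  have hTπ : ∀ d, T d → T (H.dishat d) := by
    rintro d ⟨i, hi, rfl | rfl⟩
    · exact ⟨i, hi, .inr rfl⟩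
    · exact ⟨i, hi, .inl (H.dishat_dishat _)⟩
  have hTa : T a := ⟨0, Nat.zero_le _, .inl rfl⟩
  have hTc : ¬ T c := by
    rintro ⟨i, hi, e | e⟩
    · exact hmin i (by omega) e.symm
    · apply hne (i + 1) (k + 1)
      rw [hk, H.rot_pow_succ_apply, ← e]
  have hsplit : ¬ (H.exchange a c).SameFace a c := fun hs => by
    have hT : T a ↔ T c := iff_of_eq <| PreGraph.SameFace.apply_eq (H := H.exchange a c) (f := T)
      (fun d => propext ⟨fun h => by
        have h' := hTτ _ h
        rwa [show (H.exchange a c).ferm ((H.exchange a c).ferm d) = d from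
          (H.exchange a c).ferm_invol d] at h', hTτ d⟩)
      (fun d => propext ⟨fun h => (H.dishat_dishat d) ▸ hTπ _ h, hTπ d⟩) hs
    exact hTc (hT.mp hTa)
  have hsame : H.SameFace c a := by
    rw [← hk]
    generalize k + 1 = j
    induction j with
    | zero => exact .refl H a
    | succ j ih =>
      rw [H.rot_pow_succ_apply]
      exact ((H.sameFace_ferm _).trans (H.sameFace_dishat _)).trans ih
  have hface : H.face c = H.face a := PreGraph.face_eq_iff.mpr hsame
  have hswap : ∀ d, H.face (Equiv.swap a c d) = H.face d := by
    intro d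
    by_cases h₁ : d = a
    · rw [h₁, Equiv.swap_apply_left, hface]
    by_cases h₂ : d = c
    · rw [h₂, Equiv.swap_apply_right, hface]
    rw [Equiv.swap_apply_of_ne_of_ne h₁ h₂]
  have hcoarse : ∀ d₁ d₂, (H.exchange a c).SameFace d₁ d₂ → H.face d₁ = H.face d₂ := by
    intro d₁ d₂ hs
    refine PreGraph.SameFace.apply_eq (H := H.exchange a c) (f := H.face) (fun d => ?_) (fun d => ?_) hs
    · change H.face (Equiv.swap a c (H.ferm (Equiv.swap a c d))) = H.face d
      rw [hswap, PreGraph.face_eq_iff.mpr (H.sameFace_ferm _)]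
      exact hswap d
    · exact PreGraph.face_eq_iff.mpr (H.sameFace_dishat d)
  let g : MulAction.orbitRel.Quotient (H.exchange a c).faceGroup (H.exchange a c).Dart →
      MulAction.orbitRel.Quotient H.faceGroup H.Dart :=
    Quotient.lift H.face hcoarse
  have hg : Function.Surjective g := by
    intro x
    induction x using Quotient.inductionOn' with
    | h d => exact ⟨(H.exchange a c).face d, rfl⟩
  have hginj : ¬ Function.Injective g := fun hi =>
    hsplit (PreGraph.face_eq_iff.mp (hi (a₁ := (H.exchange a c).face a)
      (a₂ := (H.exchange a c).face c) hface.symm))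
  refine lt_of_le_of_ne (Nat.card_le_card_of_surjective g hg) fun he => hginj ?_
  exact ((Nat.bijective_iff_surjective_and_card g).mpr ⟨hg, he.symm⟩).injective

theorem PreGraph.IsLine.eq_of_mem {H : PreGraph q} {e : Set H.Dart} (he : H.IsLine e) {d : H.Dart}
    (hd : d ∈ e) : e = {d, H.ferm d} := by
  obtain ⟨d', rfl⟩ := he
  rcases hd with rfl | rfl
  · rfl
  · rw [H.ferm_invol, Set.pair_comm]

/-- If `e₁ ≠ e₂` are fermionic lines of an SYK graph `G`
belonging to a common face and `{e₁, e₂}` is not a 2-cut of `G`, then some SYK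
graph `G'` with the same number of vertices has strictly more faces; in
particular `G` does not maximize the number of faces at `|V(G)|` vertices. -/
theorem syk_not_max_of_shared_face_pair_not_two_cut (q : ℕ) (hq : 2 ≤ q)
    (G : Graph q) (e₁ e₂ : Set G.toPreGraph.Dart)
    (h1 : G.toPreGraph.IsLine e₁) (h2 : G.toPreGraph.IsLine e₂)
    (hne : e₁ ≠ e₂) (hface : G.toPreGraph.LinesShareFace e₁ e₂)
    (hcut : ¬ G.toPreGraph.TwoCutPlus e₁ e₂) :
    (∃ G' : Graph q, G'.toPreGraph.nV = G.toPreGraph.nV ∧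
        G.toPreGraph.F < G'.toPreGraph.F) ∧
      ¬ ∀ G'' : Graph q, G''.toPreGraph.nV = G.toPreGraph.nV →
          G''.toPreGraph.F ≤ G.toPreGraph.F := by
  suffices h : ∃ G' : Graph q, G'.toPreGraph.nV = G.toPreGraph.nV ∧
      G.toPreGraph.F < G'.toPreGraph.F from
    ⟨h, fun hmax => by
      obtain ⟨G', hV, hF⟩ := h
      exact absurd (hmax G' hV) (not_le.mpr hF)⟩
  obtain ⟨a, ha, d, hd, hs⟩ := hface
  have he₁ := h1.eq_of_mem ha
  obtain ⟨c, hc, hrot⟩ : ∃ c ∈ e₂, ∃ k : ℕ, (G.rot ^ k) a = c := by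
    have he₂ := h2.eq_of_mem hd
    obtain ⟨k, hk | hk⟩ := hs.exists_rot_pow
    · exact ⟨d, hd, k, hk⟩
    · exact ⟨G.ferm d, by rw [he₂]; exact .inr rfl, k, hk⟩
  have he₂ := h2.eq_of_mem hc
  have hac : a ≠ c := by
    rintro rfl
    exact hne (he₁.trans he₂.symm)
  have hlt := G.F_lt_F_exchange hac hrot
  have hconn : ∀ v w, Relation.ReflTransGen ((G.exchange a c).adjPlusOff ∅) v w := by
    intro v w
    refine Relation.ReflTransGen.mono ?_ v w (not_not.mp hcut v w)
    rintro x y (⟨m, m', hm, h⟩ | h)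
    · refine .inl ⟨m, m', Set.notMem_empty _, ?_⟩
      simp only [he₁, he₂, Set.mem_union, Set.mem_insert_iff, Set.mem_singleton_iff,
        not_or] at hm
      exact (G.exchange_ferm_of_ne hm.1.1 hm.2.1 hm.1.2 hm.2.2).trans h
    · exact .inr h
  let m₀ : Fin q := ⟨0, by omega⟩
  let m₁ : Fin q := ⟨1, by omega⟩
  have hm : m₁ ≠ m₀ := by simp [m₀, m₁]
  obtain ⟨S, hS, hcard⟩ := (G.exchange a c).exists_disorder_representatives
  have hle := (G.exchange a c).F_le_of_connected m₀ hconn S hS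
  obtain ⟨k, hk⟩ : ∃ k, S.card = k + 1 := by
    refine Nat.exists_eq_succ_of_ne_zero fun h => ?_
    have : 0 < (G.exchange a c).nV := Nat.card_pos
    omega
  refine ⟨⟨necklace k m₀, necklace_conn0 k hm⟩, ?_, ?_⟩
  · exact (nV_necklace k m₀).trans (hk ▸ hcard.symm)
  · rw [hk] at hle
    exact hlt.trans_le (hle.trans (le_F_necklace k m₀))

end SYK
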